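/- Let B = 𝔪:𝔪. The following are equivalent: (1) R is almost Gorenstein; (2) a non-principal fractional ideal I of R is reflexive if and only if I is a fractional ideal of B (i.e. B ⊆ I:I); (3) a non-principal regular ideal I of R is reflexive if and only if I is an ideal of B. -/

import Mathlib

open scoped nonZeroDivisors

noncomputable section

/-- `x ∈ R` is integral over the ideal `I`: it satisfies an equation of integral
dependence over `I`, i.e. a monic polynomial whose coefficient in degree
`deg - i` lies in `I ^ i`. -/
def IsIntegralOverIdeal {R : Type*} [CommRing R] (I : Ideal R) (x : R) : Prop :=
  ∃ p : Polynomial R, p.Monic ∧ (∀ i < p.natDegree, p.coeff i ∈ I ^ (p.natDegree - i)) ∧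
    Polynomial.eval x p = 0

/-- The integral closure of the ideal `I`, viewed as an `R`-submodule of `Q(R)`. -/
def intCl (R : Type*) [CommRing R] (I : Ideal R) : Submodule R (FractionRing R) :=
  Submodule.span R (algebraMap R (FractionRing R) '' {r : R | IsIntegralOverIdeal I r})

/-- `J` is a reduction of `I`: `J ⊆ I` and `J I^n = I^(n+1)` for some `n`. -/
def IsIdealReduction {R : Type*} [CommRing R] (J I : Ideal R) : Prop :=
  J ≤ I ∧ ∃ n : ℕ, J * I ^ n = I ^ (n + 1)

/-- `J` is a minimal reduction of `I`: no reduction of `I` is properly contained in `J`. -/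
def IsMinimalReduction {R : Type*} [CommRing R] (J I : Ideal R) : Prop :=
  IsIdealReduction J I ∧ ∀ K : Ideal R, IsIdealReduction K I → K ≤ J → K = J

/-- The ideal `I` of `R`, viewed as an `R`-submodule of `Q(R)`. -/
def idl (R : Type*) [CommRing R] (I : Ideal R) : Submodule R (FractionRing R) :=
  Submodule.map (Algebra.linearMap R (FractionRing R)) I

/-- The integral closure `R̄` of `R` in `Q(R)`, as an `R`-submodule of `Q(R)`. -/
def Rbar (R : Type*) [CommRing R] : Submodule R (FractionRing R) :=
  Subalgebra.toSubmodule (integralClosure R (FractionRing R))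

/-- The condC `C = R : R̄`, as an `R`-submodule of `Q(R)`. -/
def condC (R : Type*) [CommRing R] : Submodule R (FractionRing R) :=
  1 / Rbar R

/-- The product `z • I` of a submodule `I` of `Q(R)` by an element `z ∈ Q(R)`. -/
def smulQ {R : Type*} [CommRing R] (z : FractionRing R)
    (I : Submodule R (FractionRing R)) : Submodule R (FractionRing R) :=
  Submodule.span R {z} * I

/-- `I` is a (regular) fractional ideal of `R`: it contains a regular
(= invertible) element of `Q(R)`, and `yI ⊆ R` for some regular `y ∈ R`. -/
def IsFracIdeal {R : Type*} [CommRing R] (I : Submodule R (FractionRing R)) : Prop :=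
  (∃ u : (FractionRing R)ˣ, (u : FractionRing R) ∈ I) ∧
    ∃ y ∈ R⁰, smulQ (algebraMap R (FractionRing R) y) I ≤ 1

/-- `z ∈ Q(R)` is a reduction of the fractional ideal `F`: `z = x/y` with `y`
regular in `R`, `yF ⊆ R`, and `(x)` a minimal reduction of the ideal `yF` of `R`. -/
def IsFracReduction {R : Type*} [CommRing R] (z : FractionRing R)
    (F : Submodule R (FractionRing R)) : Prop :=
  ∃ x y : R, y ∈ R⁰ ∧
    z * algebraMap R (FractionRing R) y = algebraMap R (FractionRing R) x ∧
    smulQ (algebraMap R (FractionRing R) y) F ≤ 1 ∧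
    IsMinimalReduction (Ideal.span {x})
      (Submodule.comap (Algebra.linearMap R (FractionRing R))
        (smulQ (algebraMap R (FractionRing R) y) F))

namespace Submodule

variable {R Q : Type*} [CommRing R] [CommRing Q] [Algebra R Q]

theorem div_mul_eq_div_div (A I J : Submodule R Q) : A / (I * J) = A / J / I := by
  refine le_antisymm ?_ ?_
  · rw [le_div_iff_mul_le, le_div_iff_mul_le, mul_assoc, ← le_div_iff_mul_le]
  · rw [le_div_iff_mul_le, ← mul_assoc, ← le_div_iff_mul_le, ← le_div_iff_mul_le]

theorem div_one_eq (A : Submodule R Q) : A / 1 = A := by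
  refine le_antisymm (fun x hx ↦ ?_) (le_div_iff_mul_le.2 (mul_one A).le)
  simpa using hx 1 (one_le.1 le_rfl)

theorem div_mul_le (I J : Submodule R Q) : I / J * J ≤ I :=
  le_div_iff_mul_le.1 le_rfl

theorem le_div_div (A I : Submodule R Q) : I ≤ A / (A / I) := by
  rw [le_div_iff_mul_le, mul_comm]
  exact div_mul_le A I

theorem one_div_eq_div_mul {W : Submodule R Q} (hW : W / W = 1) (I : Submodule R Q) :
    1 / I = W / (I * W) := by
  rw [div_mul_eq_div_div, hW]

/-- The subalgebra `N : N`. -/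
def divSelf (N : Submodule R Q) : Subalgebra R Q :=
  (N / N).toSubalgebra (one_mem_div.2 le_rfl) fun x y hx hy z hz ↦ by
    rw [mul_assoc]
    exact hx _ (hy _ hz)

/-- An ideal of a subalgebra whose extension by integral elements is the unit ideal
is itself the unit ideal. -/
theorem one_mem_of_one_mem_mul_of_isIntegral (S : Subalgebra R Q) (A W : Submodule R Q)
    (hAS : ∀ a ∈ A, a ∈ S) (hSA : ∀ s ∈ S, ∀ a ∈ A, s * a ∈ A)
    (hW : ∀ w ∈ W, IsIntegral R w) (h : (1 : Q) ∈ A * W) : (1 : Q) ∈ A := by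
  let a : Ideal S :=
    { carrier := {s | (s : Q) ∈ A}
      add_mem' := fun hx hy ↦ A.add_mem hx hy
      zero_mem' := A.zero_mem
      smul_mem' := fun c x hx ↦ hSA c c.2 x hx }
  let f : S →+* integralClosure S Q := algebraMap S (integralClosure S Q)
  have key : ∀ x ∈ A * W, ∃ c ∈ a.map f, (c : Q) = x := by
    intro x hx
    induction hx using Submodule.mul_induction_on' with
    | mem_mul_mem m hm n hn =>
      refine ⟨f ⟨m, hAS m hm⟩ * ⟨n, (hW n hn).tower_top⟩,
        Ideal.mul_mem_right _ _ (Ideal.mem_map_of_mem f (show (⟨m, hAS m hm⟩ : S) ∈ a from hm)), rfl⟩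
    | add x _ y _ hx hy =>
      obtain ⟨c, hc, rfl⟩ := hx
      obtain ⟨d, hd, rfl⟩ := hy
      exact ⟨c + d, Ideal.add_mem _ hc hd, rfl⟩
  obtain ⟨c, hc, hc1⟩ := key 1 h
  have hc' : c = 1 := Subtype.ext hc1
  have htop : a.map f = ⊤ := (Ideal.eq_top_iff_one _).2 (hc' ▸ hc)
  have hinj : Function.Injective f := fun x y hxy ↦
    Subtype.ext (congrArg (fun z : integralClosure S Q ↦ (z : Q)) hxy)
  have hint : f.IsIntegral := fun x ↦ Algebra.IsIntegral.isIntegral (R := S) x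
  rw [Ideal.map_eq_top_iff f hinj hint] at htop
  exact (Ideal.eq_top_iff_one _).1 htop

theorem one_div_one_div_span_unit (u : Qˣ) :
    (1 : Submodule R Q) / (1 / span R {(u : Q)}) = span R {(u : Q)} := by
  refine le_antisymm (fun x hx ↦ ?_) (le_div_div _ _)
  have hu : (↑u⁻¹ : Q) ∈ (1 : Submodule R Q) / span R {(u : Q)} := by
    intro y hy
    obtain ⟨r, rfl⟩ := mem_span_singleton.1 hy
    exact mem_one.2 ⟨r, by simp [Algebra.algebraMap_eq_smul_one]⟩
  obtain ⟨r, hr⟩ := mem_one.1 (hx _ hu)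
  refine mem_span_singleton.2 ⟨r, ?_⟩
  rw [Algebra.smul_def, hr, mul_assoc, Units.inv_mul, mul_one]

theorem one_div_one_div_of_span_unit_mul (u : Qˣ) {I : Submodule R Q}
    (h : (1 : Submodule R Q) / (1 / (span R {(u : Q)} * I)) = span R {(u : Q)} * I) :
    (1 : Submodule R Q) / (1 / I) = I := by
  refine le_antisymm (fun x hx ↦ ?_) (le_div_div _ _)
  have hux : (u : Q) * x ∈ (1 : Submodule R Q) / (1 / (span R {(u : Q)} * I)) := by
    intro w hw
    have : w * u ∈ (1 : Submodule R Q) / I := fun i hi ↦ by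
      rw [mul_assoc]
      exact hw _ (mul_mem_mul (mem_span_singleton_self _) hi)
    rw [show (u : Q) * x * w = x * (w * u) by ring]
    exact hx _ this
  rw [h, mem_span_singleton_mul] at hux
  obtain ⟨z, hz, hzx⟩ := hux
  rwa [← u.isUnit.mul_left_cancel hzx]

/-- The key duality: over a dualizing `W ⊇ 1` contained in `N : N`, every `N : N`-module
is reflexive. -/
theorem one_div_one_div_of_le {W I B : Submodule R Q} (hW : W / W = 1) (h1 : 1 ≤ W)
    (hWB : W ≤ B) (hB : B ≤ I / I) (hI : W / (W / I) = I) :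
    (1 : Submodule R Q) / (1 / I) = I := by
  have hle : I * W ≤ I := by
    rw [mul_comm]
    exact le_div_iff_mul_le.1 (hWB.trans hB)
  have absorb : ∀ J : Submodule R Q, J * W ≤ J → 1 / J = W / J := fun J hJ ↦ by
    rw [one_div_eq_div_mul hW, le_antisymm hJ ((mul_one J).ge.trans (mul_le_mul_right h1 J))]
  rw [absorb I hle, absorb _ ?_, hI]
  rw [le_div_iff_mul_le, mul_assoc, mul_comm W I]
  exact (mul_le_mul_right hle _).trans (div_mul_le W I)

end Submodule

section LocalRing

open IsLocalRing Submodule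

variable {R : Type*} [CommRing R]

theorem exists_unit_eq_algebraMap {y : R} (hy : y ∈ R⁰) :
    ∃ u : (FractionRing R)ˣ, (u : FractionRing R) = algebraMap R (FractionRing R) y :=
  IsLocalization.map_units (FractionRing R) (⟨y, hy⟩ : R⁰)

theorem isFracIdeal_one : IsFracIdeal (1 : Submodule R (FractionRing R)) :=
  ⟨⟨1, one_le.1 le_rfl⟩, 1, one_mem _, by simp [smulQ, ← one_eq_span]⟩

theorem mem_idl {I : Ideal R} {r : R} :
    algebraMap R (FractionRing R) r ∈ idl R I ↔ r ∈ I := by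
  refine ⟨?_, fun h ↦ ⟨r, h, rfl⟩⟩
  rintro ⟨s, hs, hsr⟩
  rwa [← IsFractionRing.injective R (FractionRing R) hsr]

theorem idl_le_one (I : Ideal R) : idl R I ≤ 1 := by
  rintro _ ⟨r, _, rfl⟩
  exact mem_one.2 ⟨r, rfl⟩

theorem idl_comap {K : Submodule R (FractionRing R)} (hK : K ≤ 1) :
    idl R (K.comap (Algebra.linearMap R (FractionRing R))) = K := by
  rw [idl, map_comap_eq, ← one_eq_range, inf_eq_right.2 hK]

theorem isFracIdeal_idl {I : Ideal R} (hI : ∃ r ∈ I, r ∈ R⁰) : IsFracIdeal (idl R I) := by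
  obtain ⟨r, hr, hr0⟩ := hI
  obtain ⟨u, hu⟩ := exists_unit_eq_algebraMap hr0
  exact ⟨⟨u, hu ▸ mem_idl.2 hr⟩, 1, one_mem _, by simpa [smulQ, ← one_eq_span] using idl_le_one I⟩

theorem idl_span_singleton (r : R) :
    idl R (Ideal.span {r}) = span R {algebraMap R (FractionRing R) r} := by
  rw [idl, Ideal.span, map_span, Set.image_singleton, Algebra.linearMap_apply]

theorem exists_eq_span_of_idl_eq_span {I : Ideal R} {x : FractionRing R}
    (h : idl R I = span R {x}) : ∃ r : R, I = Ideal.span {r} := by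
  obtain ⟨r, -, rfl⟩ : x ∈ idl R I := h ▸ mem_span_singleton_self x
  refine ⟨r, map_injective_of_injective (f := Algebra.linearMap R (FractionRing R))
    (IsFractionRing.injective R (FractionRing R)) ?_⟩
  exact h.trans (idl_span_singleton r).symm

/-- In a local ring, the trace `(R : I)I` of a non-principal `I` is contained in the maximal ideal. -/
theorem one_div_mul_le_idl_maximalIdeal [IsLocalRing R] {I : Submodule R (FractionRing R)}
    (hI : ¬∃ x : FractionRing R, I = span R {x}) :
    1 / I * I ≤ idl R (maximalIdeal R) := by
  by_contra hle
  rw [mul_le] at hle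
  push Not at hle
  obtain ⟨j, hj, i, hi, hji⟩ := hle
  obtain ⟨r, hr⟩ := mem_one.1 (hj i hi)
  rw [← hr, mem_idl, mem_maximalIdeal, mem_nonunits_iff, not_not] at hji
  obtain ⟨u, rfl⟩ := hji
  refine hI ⟨i, le_antisymm (fun x hx ↦ ?_) ((span_singleton_le_iff_mem _ _).2 hi)⟩
  obtain ⟨s, hs⟩ := mem_one.1 (hj x hx)
  refine mem_span_singleton.2 ⟨↑u⁻¹ * s, ?_⟩
  have hu : algebraMap R (FractionRing R) ↑u⁻¹ * algebraMap R (FractionRing R) u = 1 := by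
    rw [← map_mul, Units.inv_mul, map_one]
  rw [Algebra.smul_def, map_mul, hs]
  linear_combination x * hu - algebraMap R (FractionRing R) ↑u⁻¹ * x * hr

theorem divSelf_le_of_reflexive [IsLocalRing R] {I : Submodule R (FractionRing R)}
    (hI : ¬∃ x : FractionRing R, I = span R {x})
    (href : (1 : Submodule R (FractionRing R)) / (1 / I) = I) :
    idl R (maximalIdeal R) / idl R (maximalIdeal R) ≤ I / I := by
  rw [Submodule.le_div_iff_mul_le]
  conv_rhs => rw [← href]
  rw [Submodule.le_div_iff_mul_le, mul_assoc, mul_comm I]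
  exact ((mul_le_mul_right (one_div_mul_le_idl_maximalIdeal hI) _).trans
    (div_mul_le _ _)).trans (idl_le_one _)

/-- If every `B`-stable regular ideal is principal or reflexive, then every `B`-stable
fractional ideal is reflexive. -/
theorem reflexive_of_forall_ideal {B K : Submodule R (FractionRing R)} (hK : IsFracIdeal K)
    (hBK : B ≤ K / K)
    (h : ∀ I : Ideal R, (∃ r ∈ I, r ∈ R⁰) → (¬∃ r : R, I = Ideal.span {r}) →
      B ≤ idl R I / idl R I → (1 : Submodule R (FractionRing R)) / (1 / idl R I) = idl R I) :
    (1 : Submodule R (FractionRing R)) / (1 / K) = K := by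
  obtain ⟨⟨v, hv⟩, y, hy, hyK⟩ := hK
  obtain ⟨u, hu⟩ := exists_unit_eq_algebraMap hy
  rw [smulQ, ← hu] at hyK
  refine one_div_one_div_of_span_unit_mul u ?_
  set I := (span R {(u : FractionRing R)} * K).comap (Algebra.linearMap R (FractionRing R))
  have hI : idl R I = span R {(u : FractionRing R)} * K := idl_comap hyK
  have huv : ((u * v : (FractionRing R)ˣ) : FractionRing R) ∈ idl R I := by
    rw [hI, Units.val_mul]
    exact mul_mem_mul (mem_span_singleton_self _) hv
  rw [← hI]
  by_cases hp : ∃ r : R, I = Ideal.span {r}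
  · obtain ⟨r, hr⟩ := hp
    rw [hr, idl_span_singleton] at huv ⊢
    obtain ⟨s, hs⟩ := mem_span_singleton.1 huv
    have hunit : IsUnit (algebraMap R (FractionRing R) r) := by
      refine isUnit_of_mul_isUnit_right (x := algebraMap R (FractionRing R) s) ?_
      rw [← Algebra.smul_def, hs]
      exact Units.isUnit _
    obtain ⟨w, hw⟩ := hunit
    rw [← hw]
    exact one_div_one_div_span_unit w
  · refine h I ?_ hp ?_
    · obtain ⟨r, hr, hru⟩ := huv
      refine ⟨r, hr, ?_⟩
      rw [Algebra.linearMap_apply] at hru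
      have : algebraMap R (FractionRing R) r ∈ (FractionRing R)⁰ := by
        rw [hru]
        exact (Units.isUnit _).mem_nonZeroDivisors
      exact mem_nonZeroDivisors_of_injective (f := algebraMap R (FractionRing R))
        (IsFractionRing.injective R (FractionRing R)) this
    · rw [hI, Submodule.le_div_iff_mul_le, mul_left_comm]
      exact mul_le_mul_right (Submodule.le_div_iff_mul_le.1 hBK) _

theorem isFracIdeal_mul {I J : Submodule R (FractionRing R)} (hI : IsFracIdeal I)
    (hJ : IsFracIdeal J) : IsFracIdeal (I * J) := by
  obtain ⟨⟨u, hu⟩, y, hy, hyI⟩ := hI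
  obtain ⟨⟨v, hv⟩, z, hz, hzJ⟩ := hJ
  refine ⟨⟨u * v, mul_mem_mul hu hv⟩, y * z, mul_mem hy hz, ?_⟩
  have hsp : span R {algebraMap R (FractionRing R) (y * z)} =
      span R {algebraMap R (FractionRing R) y} * span R {algebraMap R (FractionRing R) z} := by
    rw [map_mul, span_mul_span, Set.singleton_mul_singleton]
  rw [smulQ, hsp, mul_mul_mul_comm, ← one_mul (1 : Submodule R (FractionRing R))]
  exact mul_le_mul' hyI hzJ

theorem isFracIdeal_div {I J : Submodule R (FractionRing R)} (hI : IsFracIdeal I)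
    (hJ : IsFracIdeal J) : IsFracIdeal (I / J) := by
  obtain ⟨⟨u, hu⟩, y, hy, hyI⟩ := hI
  obtain ⟨⟨v, hv⟩, z, hz, hzJ⟩ := hJ
  obtain ⟨w, hw⟩ := exists_unit_eq_algebraMap hz
  refine ⟨⟨u * w, fun j hj ↦ ?_⟩, ?_⟩
  · obtain ⟨r, hr⟩ := mem_one.1 (hzJ (mul_mem_mul (mem_span_singleton_self _) hj))
    rw [Units.val_mul, hw, mul_assoc, ← hr, mul_comm, ← Algebra.smul_def]
    exact I.smul_mem r hu
  · obtain ⟨⟨a, b⟩, hab⟩ := IsLocalization.surj (M := R⁰) (v : FractionRing R)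
    have hb := IsLocalization.map_units (FractionRing R) b
    have ha : a ∈ R⁰ := by
      refine mem_nonZeroDivisors_of_injective (f := algebraMap R (FractionRing R))
        (IsFractionRing.injective R (FractionRing R)) ?_
      rw [← hab]
      exact (v.isUnit.mul hb).mem_nonZeroDivisors
    refine ⟨y * a, mul_mem hy ha, ?_⟩
    rw [smulQ, mul_le]
    intro m hm x hx
    obtain ⟨r, rfl⟩ := mem_span_singleton.1 hm
    obtain ⟨s, hs⟩ := mem_one.1 (hyI (mul_mem_mul (mem_span_singleton_self _) (hx _ hv)))
    refine mem_one.2 ⟨r * b * s, ?_⟩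
    rw [Algebra.smul_def, map_mul, map_mul, map_mul, hs, ← hab]
    ring

theorem isFracIdeal_idl_div_idl {I : Ideal R} (hI : ∃ r ∈ I, r ∈ R⁰) :
    IsFracIdeal (idl R I / idl R I) :=
  isFracIdeal_div (isFracIdeal_idl hI) (isFracIdeal_idl hI)

/-- If all fractional ideals stable under the overring `N : N` are reflexive, then a canonical
ideal `1 ⊆ ω` of integral elements lies in `N : N`. -/
theorem le_div_self_of_forall_reflexive {N ω : Submodule R (FractionRing R)}
    (hB : IsFracIdeal (N / N)) (hωfrac : IsFracIdeal ω) (hω1 : 1 ≤ ω)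
    (hωint : ∀ w ∈ ω, IsIntegral R w)
    (hωcan : ∀ I : Submodule R (FractionRing R), IsFracIdeal I → ω / (ω / I) = I)
    (href : ∀ K : Submodule R (FractionRing R), IsFracIdeal K → N / N ≤ K / K →
      (1 : Submodule R (FractionRing R)) / (1 / K) = K) : ω ≤ N / N := by
  have hωω : ω / ω = 1 := by simpa only [div_one_eq] using hωcan 1 isFracIdeal_one
  have hBB : N / N * (N / N) ≤ N / N := by
    rw [Submodule.le_div_iff_mul_le, mul_assoc]
    exact (mul_le_mul_right (div_mul_le N N) _).trans (div_mul_le N N)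
  set B := N / N
  have hK : IsFracIdeal (ω / B) := isFracIdeal_div hωfrac hB
  have hBK : B * (ω / B) ≤ ω / B := by
    rw [Submodule.le_div_iff_mul_le, mul_comm B, mul_assoc]
    exact (mul_le_mul_right hBB _).trans (div_mul_le ω B)
  set K := ω / B
  set A := (1 : Submodule R (FractionRing R)) / K
  have hA : IsFracIdeal A := isFracIdeal_div isFracIdeal_one hK
  have hAω : A * ω = B := by
    rw [← hωcan (A * ω) (isFracIdeal_mul hA hωfrac), ← one_div_eq_div_mul hωω,
      href K hK (Submodule.le_div_iff_mul_le.2 hBK), hωcan B hB]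
  have hAB : A ≤ B := by
    rw [← hAω]
    exact (mul_one A).ge.trans (mul_le_mul_right hω1 A)
  have hBA : B * A ≤ A := by
    rw [Submodule.le_div_iff_mul_le, mul_comm B, mul_assoc]
    exact (mul_le_mul_right hBK _).trans (div_mul_le _ _)
  have h1 : (1 : FractionRing R) ∈ A := by
    refine one_mem_of_one_mem_mul_of_isIntegral N.divSelf A ω hAB
      (fun s hs a ha ↦ hBA (mul_mem_mul hs ha)) hωint ?_
    rw [hAω]
    exact one_mem_div.2 le_rfl
  rw [← hAω]
  exact (one_mul ω).ge.trans (mul_le_mul_left (one_le.2 h1) ω)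

end LocalRing

theorem statement_12
    (R : Type*) [CommRing R] [IsNoetherianRing R] [IsLocalRing R] [IsReduced R]
    (hdim : ringKrullDim R = 1)
    (hCM : ∃ x ∈ IsLocalRing.maximalIdeal R, x ∈ R⁰)
    [Infinite (IsLocalRing.ResidueField R)]
    (hfin : (Subalgebra.toSubmodule (integralClosure R (FractionRing R))).FG)
    (ω : Submodule R (FractionRing R)) (hωfrac : IsFracIdeal ω)
    (hω1 : 1 ≤ ω) (hω2 : ω ≤ Rbar R)
    (hωcan : ∀ I : Submodule R (FractionRing R), IsFracIdeal I → ω / (ω / I) = I) :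
    ((idl R (IsLocalRing.maximalIdeal R) * ω ≤ idl R (IsLocalRing.maximalIdeal R)) ↔
      (∀ I : Submodule R (FractionRing R), IsFracIdeal I →
        (¬∃ x : FractionRing R, I = Submodule.span R {x}) →
        (((1 : Submodule R (FractionRing R)) / (1 / I) = I) ↔
          idl R (IsLocalRing.maximalIdeal R) / idl R (IsLocalRing.maximalIdeal R) ≤ I / I))) ∧
    ((idl R (IsLocalRing.maximalIdeal R) * ω ≤ idl R (IsLocalRing.maximalIdeal R)) ↔
      (∀ I : Ideal R, (∃ r ∈ I, r ∈ R⁰) →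
        (¬∃ r : R, I = Ideal.span {r}) →
        (((1 : Submodule R (FractionRing R)) / (1 / idl R I) = idl R I) ↔
          idl R (IsLocalRing.maximalIdeal R) / idl R (IsLocalRing.maximalIdeal R) ≤
            idl R I / idl R I))) := by
  have hωω : ω / ω = 1 := by
    simpa only [Submodule.div_one_eq] using hωcan 1 isFracIdeal_one
  have hforward : idl R (IsLocalRing.maximalIdeal R) * ω ≤ idl R (IsLocalRing.maximalIdeal R) →
      ∀ I : Submodule R (FractionRing R), IsFracIdeal I →
        (¬∃ x : FractionRing R, I = Submodule.span R {x}) →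
        (((1 : Submodule R (FractionRing R)) / (1 / I) = I) ↔
          idl R (IsLocalRing.maximalIdeal R) / idl R (IsLocalRing.maximalIdeal R) ≤ I / I) := by
    intro h I hI hnp
    rw [mul_comm, ← Submodule.le_div_iff_mul_le] at h
    exact ⟨divSelf_le_of_reflexive hnp,
      fun hB ↦ Submodule.one_div_one_div_of_le hωω hω1 h hB (hωcan I hI)⟩
  have hrestrict : (∀ I : Submodule R (FractionRing R), IsFracIdeal I →
        (¬∃ x : FractionRing R, I = Submodule.span R {x}) →
        (((1 : Submodule R (FractionRing R)) / (1 / I) = I) ↔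
          idl R (IsLocalRing.maximalIdeal R) / idl R (IsLocalRing.maximalIdeal R) ≤ I / I)) →
      ∀ I : Ideal R, (∃ r ∈ I, r ∈ R⁰) → (¬∃ r : R, I = Ideal.span {r}) →
        (((1 : Submodule R (FractionRing R)) / (1 / idl R I) = idl R I) ↔
          idl R (IsLocalRing.maximalIdeal R) / idl R (IsLocalRing.maximalIdeal R) ≤
            idl R I / idl R I) := fun h I hI hnp ↦
    h (idl R I) (isFracIdeal_idl hI) fun ⟨_, hx⟩ ↦ hnp (exists_eq_span_of_idl_eq_span hx)
  have hback : (∀ I : Ideal R, (∃ r ∈ I, r ∈ R⁰) → (¬∃ r : R, I = Ideal.span {r}) →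
        (((1 : Submodule R (FractionRing R)) / (1 / idl R I) = idl R I) ↔
          idl R (IsLocalRing.maximalIdeal R) / idl R (IsLocalRing.maximalIdeal R) ≤
            idl R I / idl R I)) →
      idl R (IsLocalRing.maximalIdeal R) * ω ≤ idl R (IsLocalRing.maximalIdeal R) := by
    intro h
    rw [mul_comm, ← Submodule.le_div_iff_mul_le]
    exact le_div_self_of_forall_reflexive (isFracIdeal_idl_div_idl hCM) hωfrac hω1
      (fun w hw ↦ hω2 hw) hωcan fun K hK hBK ↦
        reflexive_of_forall_ideal hK hBK fun I hI hnp ↦ (h I hI hnp).2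
  exact ⟨⟨hforward, fun h ↦ hback (hrestrict h)⟩, ⟨fun h ↦ hrestrict (hforward h), hback⟩⟩
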